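/- In any 3-quasi-Sasakian manifold, the Levi-Civita connection ∇ of g satisfies ∇ξ_α = −(c/2) ψ_α for each α ∈ {1,2,3}, i.e. ∇_X ξ_α = −(c/2) ψ_α X for every vector field X. -/

import Mathlib

/-!
An abstract (Lie–Rinehart style) algebraic model of the differential geometry of
almost contact metric 3-structures: `F` plays the role of the algebra of smooth
functions on a manifold `M` of dimension `4n+3`, and `V` plays the role of the
`F`-module of smooth vector fields, acting on `F` by derivations and carrying a
Lie bracket, a Riemannian metric `g`, and three almost contact metric structures
`(φ_α, ξ_α, η_α, g)`.
-/

noncomputable section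

namespace QS3

/-- Cyclic (= even) permutations of `{0,1,2}`, modelling even permutations of `{1,2,3}`. -/
def Cyclic (a b c : Fin 3) : Prop :=
  (a, b, c) = (0, 1, 2) ∨ (a, b, c) = (1, 2, 0) ∨ (a, b, c) = (2, 0, 1)

/-- The algebraic model of the smooth structure of a manifold: an `ℝ`-algebra `F`
of smooth functions and an `F`-module `V` of vector fields acting on `F` by
derivations and carrying the Lie bracket of vector fields. -/
class SmoothSetting (F : Type) (V : Type) [CommRing F] [Algebra ℝ F]
    [AddCommGroup V] [Module F V] where
  act : V → F → F
  bracket : V → V → V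
  act_add : ∀ (X : V) (f₁ f₂ : F), act X (f₁ + f₂) = act X f₁ + act X f₂
  act_mul : ∀ (X : V) (f₁ f₂ : F), act X (f₁ * f₂) = act X f₁ * f₂ + f₁ * act X f₂
  act_const : ∀ (X : V) (r : ℝ), act X (algebraMap ℝ F r) = 0
  act_addLeft : ∀ (X Y : V) (f : F), act (X + Y) f = act X f + act Y f
  act_smulLeft : ∀ (f : F) (X : V) (h : F), act (f • X) h = f * act X h
  bracket_antisymm : ∀ X Y : V, bracket X Y = -bracket Y X
  bracket_addLeft : ∀ X Y Z : V, bracket (X + Y) Z = bracket X Z + bracket Y Z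
  bracket_act : ∀ (X Y : V) (f : F),
    act (bracket X Y) f = act X (act Y f) - act Y (act X f)
  bracket_smulRight : ∀ (X : V) (f : F) (Y : V),
    bracket X (f • Y) = f • bracket X Y + act X f • Y
  jacobi : ∀ X Y Z : V,
    bracket X (bracket Y Z) + bracket Y (bracket Z X) + bracket Z (bracket X Y) = 0

section d

variable (F V : Type) [CommRing F] [Algebra ℝ F] [AddCommGroup V] [Module F V]
  [SmoothSetting F V]

/-- The action of a vector field on a function (directional derivative). -/
def der (X : V) (f : F) : F := SmoothSetting.act X f

/-- The Lie bracket of vector fields. -/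
def lie (X Y : V) : V := SmoothSetting.bracket F X Y

/-- Exterior differential of a 1-form (with the `1/2` normalization convention,
so that `2 dθ(X,Y) = X θ(Y) - Y θ(X) - θ([X,Y])`). -/
def dOne (θ : V → F) (X Y : V) : F :=
  (2 : ℝ)⁻¹ • (der F V X (θ Y) - der F V Y (θ X) - θ (lie F V X Y))

/-- Exterior differential of a 2-form (with the `1/3` normalization convention). -/
def dTwo (ω : V → V → F) (X Y Z : V) : F :=
  (3 : ℝ)⁻¹ • (der F V X (ω Y Z) + der F V Y (ω Z X) + der F V Z (ω X Y)
    - ω (lie F V X Y) Z - ω (lie F V Y Z) X - ω (lie F V Z X) Y)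

end d

/-- An almost contact metric 3-structure on a manifold of dimension `4n+3`:
three almost contact metric structures `(φ_α, ξ_α, η_α, g)` satisfying the
quaternionic-type relations, together with a (local) orthonormal frame. -/
class ACM3 (F V : Type) [CommRing F] [Algebra ℝ F] [AddCommGroup V] [Module F V]
    [SmoothSetting F V] where
  n : ℕ
  g : V → V → F
  phi : Fin 3 → V → V
  xi : Fin 3 → V
  eta : Fin 3 → V → F
  g_symm : ∀ X Y, g X Y = g Y X
  g_addLeft : ∀ X Y Z, g (X + Y) Z = g X Z + g Y Z
  g_smulLeft : ∀ (f : F) (X Y : V), g (f • X) Y = f * g X Y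
  g_nondeg : ∀ X, (∀ Y, g X Y = 0) → X = 0
  phi_add : ∀ α (X Y : V), phi α (X + Y) = phi α X + phi α Y
  phi_smul : ∀ α (f : F) (X : V), phi α (f • X) = f • phi α X
  eta_eq : ∀ α X, eta α X = g X (xi α)
  acm_sq : ∀ α X, phi α (phi α X) = -X + eta α X • xi α
  eta_xi : ∀ α, eta α (xi α) = 1
  compat : ∀ α X Y, g (phi α X) (phi α Y) = g X Y - eta α X * eta α Y
  quat_phi : ∀ a b c, Cyclic a b c → ∀ X, phi c X = phi a (phi b X) - eta b X • xi a
  quat_phi' : ∀ a b c, Cyclic a b c → ∀ X, phi c X = -(phi b (phi a X)) + eta a X • xi b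
  quat_xi : ∀ a b c, Cyclic a b c → xi c = phi a (xi b)
  quat_xi' : ∀ a b c, Cyclic a b c → xi c = -(phi b (xi a))
  quat_eta : ∀ a b c, Cyclic a b c → ∀ X, eta c X = eta a (phi b X)
  quat_eta' : ∀ a b c, Cyclic a b c → ∀ X, eta c X = -(eta b (phi a X))
  frame : Fin (4 * n + 3) → V
  frame_orth : ∀ i j, g (frame i) (frame j) = if i = j then 1 else 0
  frame_span : ∀ X : V, X = ∑ i, g X (frame i) • frame i

section acm

variable (F V : Type) [CommRing F] [Algebra ℝ F] [AddCommGroup V] [Module F V]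
  [SmoothSetting F V] [ACM3 F V]

/-- The integer `n` (the manifold has dimension `4n+3`). -/
def dimn : ℕ := ACM3.n F V

/-- The Riemannian metric. -/
def gm (X Y : V) : F := ACM3.g X Y

/-- The structure tensors `φ_α`. -/
def ph (α : Fin 3) (X : V) : V := ACM3.phi F α X

/-- The Reeb vector fields `ξ_α`. -/
def rxi (α : Fin 3) : V := ACM3.xi F α

/-- The 1-forms `η_α`. -/
def et (α : Fin 3) (X : V) : F := ACM3.eta α X

/-- The orthonormal frame. -/
def fr (i : Fin (4 * dimn F V + 3)) : V := ACM3.frame i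

/-- The fundamental 2-form `Φ_α(X,Y) = g(X, φ_α Y)`. -/
def Phi (α : Fin 3) (X Y : V) : F := gm F V X (ph F V α Y)

/-- The Nijenhuis torsion `[φ_α, φ_α]` of `φ_α`. -/
def Nij (α : Fin 3) (X Y : V) : V :=
  ph F V α (ph F V α (lie F V X Y)) + lie F V (ph F V α X) (ph F V α Y)
    - ph F V α (lie F V (ph F V α X) Y) - ph F V α (lie F V X (ph F V α Y))

/-- The normality tensor `N⁽¹⁾_α = [φ_α, φ_α] + 2 dη_α ⊗ ξ_α`. -/
def NOne (α : Fin 3) (X Y : V) : V :=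
  Nij F V α X Y + ((2 : ℝ) • dOne F V (et F V α) X Y) • rxi F V α

/-- The structure `(φ_α, ξ_α, η_α)` is normal. -/
def IsNormal (α : Fin 3) : Prop := ∀ X Y, NOne F V α X Y = 0

/-- A 2-form is closed. -/
def IsClosedTwo (ω : V → V → F) : Prop := ∀ X Y Z, dTwo F V ω X Y Z = 0

/-- The structure `(φ_α, ξ_α, η_α, g)` is quasi-Sasakian: normal with closed
fundamental 2-form. -/
def IsQuasiSasakian (α : Fin 3) : Prop :=
  IsNormal F V α ∧ IsClosedTwo F V (Phi F V α)

/-- `M` is 3-cosymplectic: each structure is normal with `dη_α = 0` and `dΦ_α = 0`. -/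
def ThreeCosymplectic : Prop :=
  ∀ α, IsNormal F V α ∧ (∀ X Y, dOne F V (et F V α) X Y = 0) ∧
    IsClosedTwo F V (Phi F V α)

/-- `M` is 3-α-Sasakian with constant `a ≠ 0`: each structure is normal (an
`α`-Sasakian structure) and `dη_δ = a Φ_δ`. -/
def Is3AlphaSasakianWith (a : ℝ) : Prop :=
  a ≠ 0 ∧ (∀ δ, IsNormal F V δ) ∧
    ∀ (δ : Fin 3) (X Y : V), dOne F V (et F V δ) X Y = algebraMap ℝ F a * Phi F V δ X Y

/-- A vector field is horizontal: it lies in `H = ∩_α ker η_α`. -/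
def Horiz (X : V) : Prop := ∀ α, et F V α X = 0

/-- A vector field is vertical: it lies in `V = ⟨ξ₁, ξ₂, ξ₃⟩`. -/
def InVert (X : V) : Prop :=
  ∃ p q r : F, X = p • rxi F V 0 + q • rxi F V 1 + r • rxi F V 2

/-- The distribution `E^{4m} = {X ∈ H : i_X dη_α = 0}`. -/
def InE4m (X : V) : Prop :=
  Horiz F V X ∧ ∀ (α : Fin 3) (Y : V), dOne F V (et F V α) X Y = 0

/-- The distribution `E^{4l}`: the orthogonal complement of `E^{4m}` in `H`. -/
def InE4l (X : V) : Prop :=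
  Horiz F V X ∧ ∀ Y, InE4m F V Y → gm F V X Y = 0

/-- The distribution `E^{4l+3} = E^{4l} ⊕ V`. -/
def InE4l3 (X : V) : Prop :=
  ∃ Y Z, InE4l F V Y ∧ InVert F V Z ∧ X = Y + Z

/-- The distribution `E^{4m+3} = E^{4m} ⊕ V`. -/
def InE4m3 (X : V) : Prop :=
  ∃ Y Z, InE4m F V Y ∧ InVert F V Z ∧ X = Y + Z

/-- The horizontal component `X_H = X - ∑_α η_α(X) ξ_α` of a vector field. -/
def horComp (X : V) : V := X - ∑ α : Fin 3, et F V α X • rxi F V α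

/-- A vector field is basic with respect to the foliation defined by `E^{4m}`. -/
def BasicE4m (X : V) : Prop :=
  InE4l3 F V X ∧ ∀ W, InE4m F V W → InE4m F V (lie F V W X)

/-- A vector field is basic with respect to the foliation defined by `E^{4l+3}`. -/
def BasicE4l3 (X : V) : Prop :=
  InE4m F V X ∧ ∀ W, InE4l3 F V W → InE4l3 F V (lie F V W X)

end acm

/-- A 3-quasi-Sasakian structure: each of the three almost contact metric
structures is quasi-Sasakian.  We also record, as part of the structure, the
standard structural facts established for such manifolds in the literature
(Cappelletti Montano–De Nicola–Dileo): the Reeb commutation relations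
`[ξ_α, ξ_β] = c ξ_γ`, the splitting `H = E^{4l} ⊕ E^{4m}` (constancy of the
rank), the `φ_α`-invariance of both distributions, and the tensors `ψ_α`
(equal to `φ_α` on `E^{4l+3}` and vanishing on `E^{4m}` when the rank is
`4l+3`, i.e. `c ≠ 0`; equal to `φ_α` on `E^{4l}` and vanishing on `E^{4m+3}`
when the rank is `4l+1`, i.e. `c = 0`). -/
class ThreeQS (F V : Type) [CommRing F] [Algebra ℝ F] [AddCommGroup V] [Module F V]
    [SmoothSetting F V] [ACM3 F V] where
  qs : ∀ α, IsQuasiSasakian F V α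
  c : ℝ
  reeb_bracket : ∀ a b c', Cyclic a b c' →
    lie F V (rxi F V a) (rxi F V b) = algebraMap ℝ F c • rxi F V c'
  horiz_split : ∀ X, Horiz F V X → ∃ Y Z, InE4l F V Y ∧ InE4m F V Z ∧ X = Y + Z
  phi_E4l : ∀ α X, InE4l F V X → InE4l F V (ph F V α X)
  phi_E4m : ∀ α X, InE4m F V X → InE4m F V (ph F V α X)
  psi : Fin 3 → V → V
  psi_add : ∀ α (X Y : V), psi α (X + Y) = psi α X + psi α Y
  psi_smul : ∀ α (f : F) (X : V), psi α (f • X) = f • psi α X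
  psi_E4l : ∀ α X, InE4l F V X → psi α X = ph F V α X
  psi_E4m : ∀ α X, InE4m F V X → psi α X = 0
  psi_vert_of_ne : c ≠ 0 → ∀ α β, psi α (rxi F V β) = ph F V α (rxi F V β)
  psi_vert_of_eq : c = 0 → ∀ α β, psi α (rxi F V β) = 0

section tqs

variable (F V : Type) [CommRing F] [Algebra ℝ F] [AddCommGroup V] [Module F V]
  [SmoothSetting F V] [ACM3 F V] [ThreeQS F V]

/-- The constant `c` with `[ξ_α, ξ_β] = c ξ_γ`. -/
def cc : ℝ := ThreeQS.c F V

/-- The tensors `ψ_α`. -/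
def psiT (α : Fin 3) (X : V) : V := ThreeQS.psi F α X

/-- The tensors `θ_α = φ_α - ψ_α`. -/
def thetaT (α : Fin 3) (X : V) : V := ph F V α X - psiT F V α X

/-- The 2-forms `Θ_α(X,Y) = g(X, θ_α Y)`. -/
def ThetaForm (α : Fin 3) (X Y : V) : F := gm F V X (thetaT F V α Y)

end tqs

/-- The 3-quasi-Sasakian manifold has rank `4l+3`: the constant `c` is nonzero
and the orthonormal frame is adapted to the splitting
`TM = E^{4l} ⊕ E^{4m} ⊕ ⟨ξ₁,ξ₂,ξ₃⟩` with `dim E^{4l} = 4l` (hence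
`dim E^{4m} = 4m`, `m = n - l`, and the rank of the `η_α` is `4l+3`). -/
class HasRank (F V : Type) [CommRing F] [Algebra ℝ F] [AddCommGroup V] [Module F V]
    [SmoothSetting F V] [ACM3 F V] [ThreeQS F V] (l : ℕ) : Prop where
  c_ne : cc F V ≠ 0
  l_le : l ≤ dimn F V
  frame_E4l : ∀ i : Fin (4 * dimn F V + 3), i.val < 4 * l → InE4l F V (fr F V i)
  frame_E4m : ∀ i : Fin (4 * dimn F V + 3), 4 * l ≤ i.val → i.val < 4 * dimn F V →
    InE4m F V (fr F V i)
  frame_xi : ∀ (i : Fin (4 * dimn F V + 3)) (a : Fin 3),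
    i.val = 4 * dimn F V + a.val → fr F V i = rxi F V a

/-- The Levi-Civita connection of `g`: the unique torsion-free metric connection. -/
class LeviCivita (F V : Type) [CommRing F] [Algebra ℝ F] [AddCommGroup V] [Module F V]
    [SmoothSetting F V] [ACM3 F V] where
  nabla : V → V → V
  nabla_addLeft : ∀ X Y Z : V, nabla (X + Y) Z = nabla X Z + nabla Y Z
  nabla_smulLeft : ∀ (f : F) (X Y : V), nabla (f • X) Y = f • nabla X Y
  nabla_addRight : ∀ X Y Z : V, nabla X (Y + Z) = nabla X Y + nabla X Z
  nabla_leibniz : ∀ (X : V) (f : F) (Y : V),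
    nabla X (f • Y) = der F V X f • Y + f • nabla X Y
  nabla_metric : ∀ X Y Z : V,
    der F V X (gm F V Y Z) = gm F V (nabla X Y) Z + gm F V Y (nabla X Z)
  nabla_torsionFree : ∀ X Y : V, nabla X Y - nabla Y X = lie F V X Y

section curv

variable (F V : Type) [CommRing F] [Algebra ℝ F] [AddCommGroup V] [Module F V]
  [SmoothSetting F V] [ACM3 F V] [LeviCivita F V]

/-- The Levi-Civita covariant derivative `∇_X Y`. -/
def nab (X Y : V) : V := LeviCivita.nabla F X Y

/-- The Riemannian curvature `R(X,Y)Z = ∇_X ∇_Y Z - ∇_Y ∇_X Z - ∇_{[X,Y]} Z`. -/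
def Rcurv (X Y Z : V) : V :=
  nab F V X (nab F V Y Z) - nab F V Y (nab F V X Z) - nab F V (lie F V X Y) Z

/-- The Ricci tensor `Ric(X,Y) = ∑_i g(R(e_i, X)Y, e_i)`. -/
def Ric (X Y : V) : F :=
  ∑ i, gm F V (Rcurv F V (fr F V i) X Y) (fr F V i)

/-- The scalar curvature. -/
def Scal : F := ∑ i, Ric F V (fr F V i) (fr F V i)

/-- `M` is Einstein: `Ric = a g` for a constant `a`. -/
def Einstein : Prop :=
  ∃ a : ℝ, ∀ X Y, Ric F V X Y = algebraMap ℝ F a * gm F V X Y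

/-- `M` is η-Einstein: `Ric = a g + b ∑_α η_α ⊗ η_α` for constants `a, b`. -/
def EtaEinstein : Prop :=
  ∃ a b : ℝ, ∀ X Y, Ric F V X Y
    = algebraMap ℝ F a * gm F V X Y
      + algebraMap ℝ F b * ∑ α : Fin 3, et F V α X * et F V α Y

end curv

/-- A (Koszul) linear connection on vector fields. -/
def IsConnection (F V : Type) [CommRing F] [Algebra ℝ F] [AddCommGroup V] [Module F V]
    [SmoothSetting F V] (D : V → V → V) : Prop :=
  (∀ X Y Z : V, D (X + Y) Z = D X Z + D Y Z) ∧
  (∀ (f : F) (X Y : V), D (f • X) Y = f • D X Y) ∧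
  (∀ X Y Z : V, D X (Y + Z) = D X Y + D X Z) ∧
  (∀ (X : V) (f : F) (Y : V), D X (f • Y) = der F V X f • Y + f • D X Y)

end QS3

namespace QS3

section calculus

variable {F V : Type} [CommRing F] [Algebra ℝ F] [AddCommGroup V] [Module F V]
  [SmoothSetting F V]

theorem der_add (X : V) (f₁ f₂ : F) : der F V X (f₁ + f₂) = der F V X f₁ + der F V X f₂ :=
  SmoothSetting.act_add X f₁ f₂

theorem der_zero (X : V) : der F V X 0 = 0 := by
  simpa using der_add X (0 : F) 0

theorem der_neg (X : V) (f : F) : der F V X (-f) = -der F V X f := by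
  rw [eq_neg_iff_add_eq_zero, ← der_add, neg_add_cancel, der_zero]

theorem der_one (X : V) : der F V X 1 = 0 := by
  simpa [der] using SmoothSetting.act_const (F := F) X 1

theorem der_const_mul (X : V) (k : ℝ) (f : F) :
    der F V X (algebraMap ℝ F k * f) = algebraMap ℝ F k * der F V X f := by
  have h := SmoothSetting.act_mul X (algebraMap ℝ F k) f
  rwa [SmoothSetting.act_const, zero_mul, zero_add] at h

theorem der_sub (X : V) (f₁ f₂ : F) : der F V X (f₁ - f₂) = der F V X f₁ - der F V X f₂ := by
  rw [sub_eq_add_neg, der_add, der_neg, sub_eq_add_neg]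

theorem der_lie (X Y : V) (f : F) :
    der F V (lie F V X Y) f = der F V X (der F V Y f) - der F V Y (der F V X f) :=
  SmoothSetting.bracket_act X Y f

theorem lie_antisymm (X Y : V) : lie F V X Y = -lie F V Y X :=
  SmoothSetting.bracket_antisymm X Y

theorem lie_neg_right (X Y : V) : lie F V X (-Y) = -lie F V X Y := by
  have h := SmoothSetting.bracket_smulRight (F := F) X (-1) Y
  have h1 : SmoothSetting.act X (-1 : F) = 0 := by
    simpa using SmoothSetting.act_const (F := F) X (-1)
  rwa [h1, zero_smul, add_zero, neg_one_smul, neg_one_smul] at h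

theorem lie_lie (X Y Z : V) :
    lie F V X (lie F V Y Z) = lie F V (lie F V X Y) Z + lie F V Y (lie F V X Z) := by
  have h : lie F V X (lie F V Y Z) + lie F V Y (lie F V Z X) + lie F V Z (lie F V X Y) = 0 :=
    SmoothSetting.jacobi X Y Z
  rw [lie_antisymm Z X, lie_neg_right, lie_antisymm Z] at h
  rw [← sub_eq_zero, ← h]
  abel

end calculus

section metric

variable {F V : Type} [CommRing F] [Algebra ℝ F] [AddCommGroup V] [Module F V]
  [SmoothSetting F V] [ACM3 F V]

theorem two_mul_cancel {x y : F} (h : 2 * x = 2 * y) : x = y := by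
  have h2 : algebraMap ℝ F 2⁻¹ * 2 = 1 := by
    rw [← map_ofNat (algebraMap ℝ F) 2, ← map_mul]
    norm_num
  linear_combination algebraMap ℝ F 2⁻¹ * h - (x - y) * h2

theorem gm_symm (X Y : V) : gm F V X Y = gm F V Y X := ACM3.g_symm X Y

theorem gm_add_left (X Y Z : V) : gm F V (X + Y) Z = gm F V X Z + gm F V Y Z :=
  ACM3.g_addLeft X Y Z

theorem gm_smul_left (f : F) (X Y : V) : gm F V (f • X) Y = f * gm F V X Y :=
  ACM3.g_smulLeft f X Y

theorem gm_zero_left (Y : V) : gm F V 0 Y = 0 := by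
  simpa using gm_smul_left (0 : F) (0 : V) Y

theorem gm_neg_left (X Y : V) : gm F V (-X) Y = -gm F V X Y := by
  simpa using gm_smul_left (-1 : F) X Y

theorem gm_sub_left (X Y Z : V) : gm F V (X - Y) Z = gm F V X Z - gm F V Y Z := by
  rw [sub_eq_add_neg, gm_add_left, gm_neg_left, sub_eq_add_neg]

theorem gm_add_right (X Y Z : V) : gm F V X (Y + Z) = gm F V X Y + gm F V X Z := by
  simp only [gm_symm X, gm_add_left]

theorem gm_smul_right (f : F) (X Y : V) : gm F V X (f • Y) = f * gm F V X Y := by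
  simp only [gm_symm X, gm_smul_left]

theorem gm_zero_right (X : V) : gm F V X 0 = 0 := by
  rw [gm_symm, gm_zero_left]

theorem gm_neg_right (X Y : V) : gm F V X (-Y) = -gm F V X Y := by
  simp only [gm_symm X, gm_neg_left]

theorem gm_sub_right (X Y Z : V) : gm F V X (Y - Z) = gm F V X Y - gm F V X Z := by
  simp only [gm_symm X, gm_sub_left]

theorem gm_ext {X Y : V} (h : ∀ Z, gm F V X Z = gm F V Y Z) : X = Y :=
  sub_eq_zero.1 <| ACM3.g_nondeg (F := F) _ fun Z => by
    change gm F V (X - Y) Z = 0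
    rw [gm_sub_left, h, sub_self]

theorem ph_add (α : Fin 3) (X Y : V) : ph F V α (X + Y) = ph F V α X + ph F V α Y :=
  ACM3.phi_add α X Y

theorem ph_smul (α : Fin 3) (f : F) (X : V) : ph F V α (f • X) = f • ph F V α X :=
  ACM3.phi_smul α f X

theorem ph_neg (α : Fin 3) (X : V) : ph F V α (-X) = -ph F V α X := by
  simpa using ph_smul α (-1 : F) X

theorem ph_sub (α : Fin 3) (X Y : V) : ph F V α (X - Y) = ph F V α X - ph F V α Y := by
  rw [sub_eq_add_neg, ph_add, ph_neg, sub_eq_add_neg]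

theorem ph_zero (α : Fin 3) : ph F V α 0 = 0 := by
  simpa using ph_smul α (0 : F) (0 : V)

theorem et_eq (α : Fin 3) (X : V) : et F V α X = gm F V X (rxi F V α) := ACM3.eta_eq α X

theorem et_add (α : Fin 3) (X Y : V) : et F V α (X + Y) = et F V α X + et F V α Y := by
  simp only [et_eq, gm_add_left]

theorem et_smul (α : Fin 3) (f : F) (X : V) : et F V α (f • X) = f * et F V α X := by
  simp only [et_eq, gm_smul_left]

theorem et_neg (α : Fin 3) (X : V) : et F V α (-X) = -et F V α X := by
  simp only [et_eq, gm_neg_left]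

theorem et_sub (α : Fin 3) (X Y : V) : et F V α (X - Y) = et F V α X - et F V α Y := by
  simp only [et_eq, gm_sub_left]

theorem et_zero (α : Fin 3) : et F V α 0 = 0 := by
  rw [et_eq, gm_zero_left]

theorem ph_sq (α : Fin 3) (X : V) :
    ph F V α (ph F V α X) = -X + et F V α X • rxi F V α := ACM3.acm_sq α X

theorem et_rxi_self (α : Fin 3) : et F V α (rxi F V α) = 1 := ACM3.eta_xi α

theorem gm_ph_ph (α : Fin 3) (X Y : V) :
    gm F V (ph F V α X) (ph F V α Y) = gm F V X Y - et F V α X * et F V α Y :=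
  ACM3.compat α X Y

theorem Cyclic.rotate {a b c : Fin 3} (h : Cyclic a b c) : Cyclic b c a := by
  unfold Cyclic at *
  simp only [Prod.mk.injEq] at *
  tauto

theorem Cyclic.exists_of_fst (a : Fin 3) : ∃ b c, Cyclic a b c := by
  unfold Cyclic
  fin_cases a
  exacts [⟨1, 2, by simp⟩, ⟨2, 0, by simp⟩, ⟨0, 1, by simp⟩]

theorem Cyclic.eq_or {a b c : Fin 3} (h : Cyclic a b c) (i : Fin 3) :
    i = a ∨ i = b ∨ i = c := by
  unfold Cyclic at h
  simp only [Prod.mk.injEq] at h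
  omega

theorem ph_rxi_next {a b c : Fin 3} (h : Cyclic a b c) :
    ph F V a (rxi F V b) = rxi F V c := (ACM3.quat_xi a b c h).symm

theorem ph_rxi_prev {a b c : Fin 3} (h : Cyclic a b c) :
    ph F V b (rxi F V a) = -rxi F V c := by
  rw [eq_neg_iff_add_eq_zero, add_comm, ← eq_neg_iff_add_eq_zero]
  exact ACM3.quat_xi' a b c h

theorem et_ph_next {a b c : Fin 3} (h : Cyclic a b c) (X : V) :
    et F V a (ph F V b X) = et F V c X := (ACM3.quat_eta a b c h X).symm

theorem et_ph_prev {a b c : Fin 3} (h : Cyclic a b c) (X : V) :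
    et F V b (ph F V a X) = -et F V c X := by
  have := ACM3.quat_eta' (F := F) a b c h X
  change et F V c X = -et F V b (ph F V a X) at this
  rw [this, neg_neg]

theorem ph_ph_next {a b c : Fin 3} (h : Cyclic a b c) (X : V) :
    ph F V a (ph F V b X) = ph F V c X + et F V b X • rxi F V a :=
  (sub_eq_iff_eq_add.1 (ACM3.quat_phi (F := F) a b c h X).symm)

theorem ph_ph_prev {a b c : Fin 3} (h : Cyclic a b c) (X : V) :
    ph F V b (ph F V a X) = -ph F V c X + et F V a X • rxi F V b := by
  have : ph F V c X = -ph F V b (ph F V a X) + et F V a X • rxi F V b :=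
    ACM3.quat_phi' a b c h X
  rw [this]
  abel

theorem et_rxi_comm (a b : Fin 3) : et F V a (rxi F V b) = et F V b (rxi F V a) := by
  rw [et_eq, et_eq, gm_symm]

theorem et_rxi_next {a b c : Fin 3} (h : Cyclic a b c) : et F V a (rxi F V b) = 0 := by
  refine two_mul_cancel ?_
  have h1 := et_ph_prev (F := F) h.rotate.rotate (rxi F V a)
  rw [ph_rxi_next h.rotate.rotate] at h1
  linear_combination h1 + et_rxi_comm (F := F) (V := V) a b

theorem et_rxi_prev {a b c : Fin 3} (h : Cyclic a b c) : et F V b (rxi F V a) = 0 := by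
  rw [et_rxi_comm, et_rxi_next h]

theorem et_ph_rxi_self (a : Fin 3) : et F V a (ph F V a (rxi F V a)) = 0 := by
  obtain ⟨b, c, h⟩ := Cyclic.exists_of_fst a
  rw [← et_ph_next h.rotate (ph F V a (rxi F V a)), ph_ph_next h.rotate.rotate,
    ph_rxi_prev h, et_rxi_self, one_smul, et_add, et_neg, neg_add_cancel]

theorem ph_rxi_self (a : Fin 3) : ph F V a (rxi F V a) = 0 := by
  have h1 : ph F V a (ph F V a (rxi F V a)) = 0 := by
    rw [ph_sq, et_rxi_self, one_smul, neg_add_cancel]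
  have h2 := ph_sq (F := F) a (ph F V a (rxi F V a))
  rw [h1, ph_zero, et_ph_rxi_self, zero_smul, add_zero] at h2
  exact neg_eq_zero.1 h2.symm

theorem et_ph_self (a : Fin 3) (X : V) : et F V a (ph F V a X) = 0 := by
  have h1 := congrArg (ph F V a) (ph_sq (F := F) a X)
  rw [ph_sq, ph_add, ph_neg, ph_smul, ph_rxi_self, smul_zero, add_zero,
    add_eq_left] at h1
  have h2 := congrArg (et F V a) h1
  simpa only [et_smul, et_rxi_self, mul_one, et_zero] using h2

theorem gm_ph_left (a : Fin 3) (X Y : V) :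
    gm F V (ph F V a X) Y = -gm F V X (ph F V a Y) := by
  have h := gm_ph_ph (F := F) a X (ph F V a Y)
  rw [ph_sq, gm_add_right, gm_neg_right, gm_smul_right, ← et_eq, et_ph_self, et_ph_self] at h
  linear_combination -h

theorem gm_rxi_left (a : Fin 3) (X : V) : gm F V (rxi F V a) X = et F V a X := by
  rw [gm_symm, et_eq]

theorem Horiz.ph {X : V} (hX : Horiz F V X) (a : Fin 3) : Horiz F V (ph F V a X) := by
  obtain ⟨b, c, h⟩ := Cyclic.exists_of_fst a
  intro i
  obtain rfl | rfl | rfl := h.eq_or i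
  · exact et_ph_self _ _
  · rw [et_ph_prev h, hX, neg_zero]
  · rw [et_ph_next h.rotate.rotate, hX]

theorem ph_sq_of_horiz {X : V} (hX : Horiz F V X) (a : Fin 3) :
    ph F V a (ph F V a X) = -X := by
  rw [ph_sq, hX, zero_smul, add_zero]

theorem horiz_horComp (X : V) : Horiz F V (horComp F V X) := by
  have h : Cyclic 0 1 2 := Or.inl rfl
  intro i
  rw [horComp, Fin.sum_univ_three]
  simp only [et_sub, et_add, et_smul]
  obtain rfl | rfl | rfl := h.eq_or i <;>
    simp only [et_rxi_self, et_rxi_next h, et_rxi_next h.rotate, et_rxi_next h.rotate.rotate,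
      et_rxi_prev h, et_rxi_prev h.rotate, et_rxi_prev h.rotate.rotate] <;> ring

theorem Horiz.smul {X : V} (hX : Horiz F V X) (f : F) : Horiz F V (f • X) :=
  fun i => by rw [et_smul, hX, mul_zero]

theorem Horiz.sub {X Y : V} (hX : Horiz F V X) (hY : Horiz F V Y) : Horiz F V (X - Y) :=
  fun i => by rw [et_sub, hX, hY, sub_zero]

theorem ph_ph_anticomm {a b c : Fin 3} (h : Cyclic a b c) {X : V} (hX : Horiz F V X) :
    ph F V a (ph F V b X) = -ph F V b (ph F V a X) := by
  rw [ph_ph_next h, ph_ph_prev h, hX, hX, zero_smul, zero_smul, add_zero, add_zero, neg_neg]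

end metric

section connection

variable {F V : Type} [CommRing F] [Algebra ℝ F] [AddCommGroup V] [Module F V]
  [SmoothSetting F V] [ACM3 F V] [LeviCivita F V]

theorem nab_add_left (X Y Z : V) : nab F V (X + Y) Z = nab F V X Z + nab F V Y Z :=
  LeviCivita.nabla_addLeft X Y Z

theorem nab_smul_left (f : F) (X Y : V) : nab F V (f • X) Y = f • nab F V X Y :=
  LeviCivita.nabla_smulLeft f X Y

theorem nab_neg_left (X Y : V) : nab F V (-X) Y = -nab F V X Y := by
  simpa using nab_smul_left (-1 : F) X Y

theorem nab_add_right (X Y Z : V) : nab F V X (Y + Z) = nab F V X Y + nab F V X Z :=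
  LeviCivita.nabla_addRight X Y Z

theorem nab_zero_right (X : V) : nab F V X 0 = 0 := by
  simpa using nab_add_right (F := F) X 0 0

theorem der_gm (X Y Z : V) :
    der F V X (gm F V Y Z) = gm F V (nab F V X Y) Z + gm F V Y (nab F V X Z) :=
  LeviCivita.nabla_metric X Y Z

theorem lie_eq_nab_sub (X Y : V) : lie F V X Y = nab F V X Y - nab F V Y X :=
  (LeviCivita.nabla_torsionFree X Y).symm

variable (F) in
/-- The covariant derivative `(∇_X η_α)(Y) = g(∇_X ξ_α, Y)`. -/
def covEta (a : Fin 3) (X Y : V) : F := gm F V (nab F V X (rxi F V a)) Y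

variable (F) in
/-- The trilinear form `g((∇_X φ_α) Y, Z)`. -/
def covPhi (a : Fin 3) (X Y Z : V) : F :=
  gm F V (nab F V X (ph F V a Y) - ph F V a (nab F V X Y)) Z

theorem covEta_eq (a : Fin 3) (X Y : V) :
    covEta F a X Y = gm F V (nab F V X (rxi F V a)) Y := rfl

theorem covPhi_eq (a : Fin 3) (X Y Z : V) :
    covPhi F a X Y Z = gm F V (nab F V X (ph F V a Y)) Z + gm F V (nab F V X Y) (ph F V a Z) := by
  rw [covPhi, gm_sub_left, gm_ph_left, sub_neg_eq_add]

theorem covPhi_skew (a : Fin 3) (X Y Z : V) : covPhi F a X Y Z = -covPhi F a X Z Y := by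
  have h1 := der_gm (F := F) X (ph F V a Y) Z
  have h2 := der_gm (F := F) X Y (ph F V a Z)
  rw [gm_ph_left, der_neg] at h1
  rw [covPhi_eq, covPhi_eq]
  linear_combination -h1 - h2 - gm_symm (F := F) Y (nab F V X (ph F V a Z))
    - gm_symm (F := F) (ph F V a Y) (nab F V X Z)

theorem covEta_rxi_self (a : Fin 3) (X : V) : covEta F a X (rxi F V a) = 0 := by
  have h := der_gm (F := F) X (rxi F V a) (rxi F V a)
  rw [gm_rxi_left, et_rxi_self, der_one, gm_symm (rxi F V a)] at h
  exact two_mul_cancel (by rw [covEta_eq]; linear_combination -h)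

theorem covPhi_rxi (a : Fin 3) (X Z : V) :
    covPhi F a X (rxi F V a) Z = covEta F a X (ph F V a Z) := by
  rw [covPhi_eq, ph_rxi_self, nab_zero_right, gm_zero_left, zero_add, covEta_eq]

theorem two_smul_dOne_et (a : Fin 3) (X Y : V) :
    (2 : ℝ) • dOne F V (et F V a) X Y = covEta F a X Y - covEta F a Y X := by
  rw [dOne, smul_inv_smul₀ two_ne_zero, et_eq, et_eq, et_eq, der_gm, der_gm, lie_eq_nab_sub,
    gm_sub_left, covEta_eq, covEta_eq]
  linear_combination gm_symm (F := F) Y (nab F V X (rxi F V a))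
    - gm_symm (F := F) X (nab F V Y (rxi F V a))

theorem covPhi_cyclic {a : Fin 3} (h : IsClosedTwo F V (Phi F V a)) (X Y Z : V) :
    covPhi F a X Y Z + covPhi F a Y Z X + covPhi F a Z X Y = 0 := by
  have h1 := h X Y Z
  rw [dTwo, smul_eq_zero_iff_right (by norm_num)] at h1
  simp only [Phi, der_gm, lie_eq_nab_sub, gm_sub_left] at h1
  have s1 := covPhi_skew (F := F) a X Y Z
  have s2 := covPhi_skew (F := F) a Y Z X
  have s3 := covPhi_skew (F := F) a Z X Y
  rw [s1, s2, s3]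
  simp only [covPhi_eq]
  linear_combination -h1 + gm_symm (F := F) Y (nab F V X (ph F V a Z))
    + gm_symm (F := F) Z (nab F V Y (ph F V a X)) + gm_symm (F := F) X (nab F V Z (ph F V a Y))

theorem covPhi_of_isNormal {a : Fin 3} (h : IsNormal F V a) (X Y Z : V) :
    covPhi F a (ph F V a X) Y Z - covPhi F a (ph F V a Y) X Z + covPhi F a X Y (ph F V a Z)
      - covPhi F a Y X (ph F V a Z)
      + (covEta F a X Y - covEta F a Y X) * et F V a Z = 0 := by
  have h1 := congrArg (fun W => gm F V W Z) (h X Y)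
  simp only [NOne, Nij, two_smul_dOne_et, lie_eq_nab_sub, ph_sub, gm_add_left, gm_sub_left,
    gm_smul_left, gm_rxi_left, gm_zero_left, gm_ph_left] at h1
  simp only [covPhi_eq]
  linear_combination h1

theorem covEta_add_right (a : Fin 3) (X Y Z : V) :
    covEta F a X (Y + Z) = covEta F a X Y + covEta F a X Z := gm_add_right _ _ _

theorem covEta_smul_right (a : Fin 3) (X : V) (f : F) (Y : V) :
    covEta F a X (f • Y) = f * covEta F a X Y := gm_smul_right _ _ _

theorem covEta_neg_right (a : Fin 3) (X Y : V) :
    covEta F a X (-Y) = -covEta F a X Y := gm_neg_right _ _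

theorem covEta_ph_ph_right (a : Fin 3) (X Y : V) :
    covEta F a X (ph F V a (ph F V a Y)) = -covEta F a X Y := by
  rw [ph_sq, covEta_add_right, covEta_smul_right, covEta_rxi_self, covEta_neg_right, mul_zero,
    add_zero]

theorem nab_zero_left (X : V) : nab F V 0 X = 0 := by
  simpa using nab_smul_left (0 : F) 0 X

theorem covPhi_zero_left (a : Fin 3) (Y Z : V) : covPhi F a 0 Y Z = 0 := by
  simp only [covPhi_eq, nab_zero_left, gm_zero_left, add_zero]

theorem covEta_zero_right (a : Fin 3) (X : V) : covEta F a X 0 = 0 := gm_zero_right _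

theorem covPhi_zero_right (a : Fin 3) (X Y : V) : covPhi F a X Y 0 = 0 := gm_zero_right _

theorem covPhi_rxi_right (a : Fin 3) (X Y : V) :
    covPhi F a X Y (rxi F V a) = -covEta F a X (ph F V a Y) := by
  rw [covPhi_skew, covPhi_rxi]

theorem covEta_rxi_left {a : Fin 3} (h : IsNormal F V a) (X : V) :
    covEta F a (rxi F V a) X = 0 := by
  have h1 := covPhi_of_isNormal h X (rxi F V a) (rxi F V a)
  rw [ph_rxi_self, covPhi_zero_left, covPhi_zero_right, covPhi_zero_right, covPhi_rxi,
    ph_rxi_self, covEta_zero_right, covEta_rxi_self, et_rxi_self] at h1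
  linear_combination -h1

theorem covPhi_rxi_left_ph {a : Fin 3} (h : IsNormal F V a) (X Z : V) :
    covPhi F a (rxi F V a) X (ph F V a Z)
      = covEta F a (ph F V a X) (ph F V a Z) - covEta F a X Z := by
  have h1 := covPhi_of_isNormal h X (rxi F V a) Z
  rw [ph_rxi_self, covPhi_zero_left, covPhi_rxi, covPhi_rxi, covEta_rxi_self,
    covEta_rxi_left h, covEta_ph_ph_right] at h1
  linear_combination -h1

theorem covPhi_rxi_left {a : Fin 3} (h : IsClosedTwo F V (Phi F V a)) (Y Z : V) :
    covPhi F a (rxi F V a) Y Z = covEta F a Y (ph F V a Z) - covEta F a Z (ph F V a Y) := by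
  have h1 := covPhi_cyclic h (rxi F V a) Y Z
  rw [covPhi_rxi_right, covPhi_rxi] at h1
  linear_combination h1

theorem covEta_ph_ph_skew {a : Fin 3} (h : IsQuasiSasakian F V a) (X Y : V) :
    covEta F a (ph F V a X) (ph F V a Y) = -covEta F a (ph F V a Y) (ph F V a X) := by
  have h1 := covPhi_rxi_left_ph h.1 X Y
  rw [covPhi_rxi_left h.2, covEta_ph_ph_right] at h1
  linear_combination -h1

theorem covEta_add_left (a : Fin 3) (X Y Z : V) :
    covEta F a (X + Y) Z = covEta F a X Z + covEta F a Y Z := by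
  simp only [covEta_eq, nab_add_left, gm_add_left]

theorem covEta_smul_left (a : Fin 3) (f : F) (X Y : V) :
    covEta F a (f • X) Y = f * covEta F a X Y := by
  simp only [covEta_eq, nab_smul_left, gm_smul_left]

theorem covEta_neg_left (a : Fin 3) (X Y : V) :
    covEta F a (-X) Y = -covEta F a X Y := by
  simp only [covEta_eq, nab_neg_left, gm_neg_left]

theorem covEta_ph_ph_left {a : Fin 3} (h : IsNormal F V a) (X Y : V) :
    covEta F a (ph F V a (ph F V a X)) Y = -covEta F a X Y := by
  rw [ph_sq, covEta_add_left, covEta_smul_left, covEta_rxi_left h, covEta_neg_left, mul_zero,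
    add_zero]

/-- The Reeb vector field of a quasi-Sasakian structure is Killing. -/
theorem covEta_skew {a : Fin 3} (h : IsQuasiSasakian F V a) (X Y : V) :
    covEta F a X Y = -covEta F a Y X := by
  have h1 := covEta_ph_ph_skew h (ph F V a X) (ph F V a Y)
  rwa [covEta_ph_ph_left h.1, covEta_ph_ph_left h.1, covEta_ph_ph_right, covEta_ph_ph_right,
    neg_neg, neg_neg] at h1

theorem covEta_ph_ph {a : Fin 3} (h : IsQuasiSasakian F V a) (X Y : V) :
    covEta F a (ph F V a X) (ph F V a Y) = covEta F a X Y := by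
  have h1 := covPhi_of_isNormal h.1 X Y (rxi F V a)
  rw [covPhi_rxi_right, covPhi_rxi_right, et_rxi_self, ph_rxi_self, covPhi_zero_right,
    covPhi_zero_right] at h1
  refine two_mul_cancel ?_
  linear_combination -h1 + covEta_skew h (ph F V a X) (ph F V a Y) - covEta_skew h X Y

theorem covEta_ph_left {a : Fin 3} (h : IsQuasiSasakian F V a) (X Y : V) :
    covEta F a (ph F V a X) Y = -covEta F a X (ph F V a Y) := by
  rw [← covEta_ph_ph h X (ph F V a Y), covEta_ph_ph_right, neg_neg]

theorem covPhi_rxi_left_eq_zero {a : Fin 3} (h : IsQuasiSasakian F V a) (Y Z : V) :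
    covPhi F a (rxi F V a) Y Z = 0 := by
  rw [covPhi_rxi_left h.2, covEta_skew h Z, covEta_ph_left h]
  ring

theorem covPhi_add_left (a : Fin 3) (W X Y Z : V) :
    covPhi F a (W + X) Y Z = covPhi F a W Y Z + covPhi F a X Y Z := by
  simp only [covPhi_eq, nab_add_left, gm_add_left]
  ring

theorem covPhi_smul_left (a : Fin 3) (f : F) (X Y Z : V) :
    covPhi F a (f • X) Y Z = f * covPhi F a X Y Z := by
  simp only [covPhi_eq, nab_smul_left, gm_smul_left]
  ring

theorem covPhi_neg_left (a : Fin 3) (X Y Z : V) :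
    covPhi F a (-X) Y Z = -covPhi F a X Y Z := by
  simpa using covPhi_smul_left a (-1 : F) X Y Z

theorem covPhi_ph_left {a : Fin 3} (h : IsQuasiSasakian F V a) (X Y Z : V) :
    covPhi F a (ph F V a X) Y Z
      = covEta F a X Z * et F V a Y - covEta F a X Y * et F V a Z := by
  have key (Y Z : V) : covPhi F a (ph F V a X) Y Z - covPhi F a (ph F V a Y) X Z
      - covPhi F a (ph F V a Z) X Y + 2 * (covEta F a X Y * et F V a Z) = 0 := by
    linear_combination covPhi_of_isNormal h.1 X Y Z - covPhi_cyclic h.2 X Y (ph F V a Z)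
      + covPhi_skew (F := F) a Y (ph F V a Z) X + et F V a Z * covEta_skew h X Y
  refine two_mul_cancel ?_
  linear_combination key Y Z - key Z Y + covPhi_skew (F := F) a (ph F V a X) Y Z

/-- The covariant derivative of the structure tensor of a quasi-Sasakian structure. -/
theorem covPhi_eq_covEta {a : Fin 3} (h : IsQuasiSasakian F V a) (X Y Z : V) :
    covPhi F a X Y Z
      = covEta F a X (ph F V a Z) * et F V a Y - covEta F a X (ph F V a Y) * et F V a Z := by
  have h1 := covPhi_ph_left h (ph F V a X) Y Z
  rw [ph_sq, covPhi_add_left, covPhi_neg_left, covPhi_smul_left, covPhi_rxi_left_eq_zero h,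
    covEta_ph_left h, covEta_ph_left h] at h1
  linear_combination -h1

theorem covEta_rxi_rxi_swap {a b c : Fin 3} (h : Cyclic a b c) (X : V) :
    covEta F a X (rxi F V b) = -covEta F b X (rxi F V a) := by
  have h1 := der_gm (F := F) X (rxi F V a) (rxi F V b)
  rw [gm_rxi_left, et_rxi_next h, der_zero, gm_symm (rxi F V a)] at h1
  rw [covEta_eq, covEta_eq]
  linear_combination -h1

theorem covEta_sub_right (a : Fin 3) (X Y Z : V) :
    covEta F a X (Y - Z) = covEta F a X Y - covEta F a X Z := gm_sub_right _ _ _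

end connection

section threeQS

variable {F V : Type} [CommRing F] [Algebra ℝ F] [AddCommGroup V] [Module F V]
  [SmoothSetting F V] [ACM3 F V] [ThreeQS F V]

theorem lie_rxi_next {a b c : Fin 3} (h : Cyclic a b c) :
    lie F V (rxi F V a) (rxi F V b) = algebraMap ℝ F (cc F V) • rxi F V c :=
  ThreeQS.reeb_bracket a b c h

theorem eq_zero_of_orthogonal {X : V} (hX : Horiz F V X)
    (hl : ∀ Y, InE4l F V Y → gm F V X Y = 0) (hm : ∀ Y, InE4m F V Y → gm F V X Y = 0) :
    X = 0 := by
  refine gm_ext (F := F) fun Z => ?_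
  obtain ⟨Y₁, Y₂, h₁, h₂, e⟩ := ThreeQS.horiz_split _ (horiz_horComp (F := F) Z)
  have hZ : Z = Y₁ + Y₂ + ∑ i : Fin 3, et F V i Z • rxi F V i := by
    rw [← e, horComp, sub_add_cancel]
  rw [hZ, Fin.sum_univ_three]
  simp only [gm_add_right, gm_smul_right, hl _ h₁, hm _ h₂, gm_zero_left, gm_symm X (rxi F V _),
    gm_rxi_left, hX _, mul_zero, add_zero]

theorem psiT_add (a : Fin 3) (X Y : V) : psiT F V a (X + Y) = psiT F V a X + psiT F V a Y :=
  ThreeQS.psi_add a X Y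

theorem psiT_smul (a : Fin 3) (f : F) (X : V) : psiT F V a (f • X) = f • psiT F V a X :=
  ThreeQS.psi_smul a f X

variable [LeviCivita F V]

theorem covEta_ph_next {a b c : Fin 3} (h : Cyclic a b c) (X : V) {Y : V}
    (hY : Horiz F V Y) : covEta F c X (ph F V c Y) = covEta F b X (ph F V b Y) := by
  have hc := covPhi_rxi_right (F := F) c X Y
  have hb := covPhi_rxi_right (F := F) b X Y
  have ha := covPhi_eq_covEta (ThreeQS.qs (F := F) a) X (ph F V b Y) (rxi F V c)
  have e : ph F V c Y = ph F V a (ph F V b Y) := by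
    rw [ph_ph_next h, hY, zero_smul, add_zero]
  rw [hY.ph b a, et_rxi_prev h.rotate.rotate, covPhi_eq, ← e, ph_rxi_prev h.rotate.rotate,
    gm_neg_right] at ha
  rw [covPhi_eq, ph_rxi_self, gm_zero_right] at hb hc
  linear_combination hc - hb - ha

theorem covEta_ph_eq (a b : Fin 3) (X : V) {Y : V} (hY : Horiz F V Y) :
    covEta F a X (ph F V a Y) = covEta F b X (ph F V b Y) := by
  obtain ⟨c, d, h⟩ := Cyclic.exists_of_fst a
  obtain rfl | rfl | rfl := h.eq_or b
  · rfl
  · rw [covEta_ph_next h.rotate.rotate X hY]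
  · rw [covEta_ph_next h.rotate X hY]

theorem nab_rxi_swap {a b c : Fin 3} (h : Cyclic a b c) :
    nab F V (rxi F V a) (rxi F V b) = -nab F V (rxi F V b) (rxi F V a) := by
  refine gm_ext (F := F) fun Z => ?_
  rw [gm_neg_left, ← covEta_eq, ← covEta_eq, covEta_skew (ThreeQS.qs b),
    covEta_skew (ThreeQS.qs a), covEta_rxi_rxi_swap h]
  ring

theorem nab_rxi_next {a b c : Fin 3} (h : Cyclic a b c) :
    nab F V (rxi F V a) (rxi F V b) = algebraMap ℝ F (cc F V / 2) • rxi F V c := by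
  refine gm_ext (F := F) fun Z => two_mul_cancel ?_
  have h1 := lie_rxi_next (F := F) (V := V) h
  rw [lie_eq_nab_sub, nab_rxi_swap h.rotate.rotate.rotate, eq_comm] at h1
  have h2 := congrArg (fun W => gm F V W Z) h1
  have h3 : algebraMap ℝ F (cc F V) = 2 * algebraMap ℝ F (cc F V / 2) := by
    rw [← map_ofNat (algebraMap ℝ F) 2, ← map_mul]
    congr 1
    ring
  have h4 := congrArg (fun W => gm F V W Z) (nab_rxi_swap (F := F) (V := V) h)
  simp only [gm_sub_left, gm_neg_left, gm_smul_left] at h2 h4 ⊢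
  rw [h3] at h2
  linear_combination 2 * h4 - h2

theorem nab_rxi_prev {a b c : Fin 3} (h : Cyclic a b c) :
    nab F V (rxi F V b) (rxi F V a) = -(algebraMap ℝ F (cc F V / 2) • rxi F V c) := by
  rw [← nab_rxi_next h, nab_rxi_swap h, neg_neg]

theorem nab_rxi_self (a : Fin 3) : nab F V (rxi F V a) (rxi F V a) = 0 := by
  refine gm_ext (F := F) fun Z => ?_
  rw [gm_zero_left, ← covEta_eq, covEta_rxi_left (ThreeQS.qs a).1]

theorem nab_rxi_rxi (a b : Fin 3) : nab F V (rxi F V b) (rxi F V a)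
    = algebraMap ℝ F (-(cc F V / 2)) • ph F V a (rxi F V b) := by
  obtain ⟨c, d, h⟩ := Cyclic.exists_of_fst a
  obtain rfl | rfl | rfl := h.eq_or b
  · rw [nab_rxi_self, ph_rxi_self, smul_zero]
  · rw [nab_rxi_prev h, ph_rxi_next h, map_neg, neg_smul]
  · rw [nab_rxi_next h.rotate.rotate, ph_rxi_prev h.rotate.rotate, map_neg, neg_smul_neg]

theorem covEta_rxi_left_of_horiz (a b : Fin 3) {X : V} (hX : Horiz F V X) :
    covEta F a (rxi F V b) X = 0 := by
  rw [covEta_eq, nab_rxi_rxi, gm_smul_left, gm_ph_left, gm_rxi_left, hX.ph, neg_zero, mul_zero]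

theorem horiz_nab_rxi {X : V} (hX : Horiz F V X) (a : Fin 3) :
    Horiz F V (nab F V X (rxi F V a)) := fun b => by
  rw [et_eq, ← covEta_eq, covEta_skew (ThreeQS.qs a), covEta_rxi_left_of_horiz a b hX, neg_zero]

theorem exists_lie_rxi_eq (a b : Fin 3) : ∃ (k : ℝ) (i : Fin 3),
    lie F V (rxi F V a) (rxi F V b) = algebraMap ℝ F k • rxi F V i := by
  obtain ⟨c, d, h⟩ := Cyclic.exists_of_fst a
  obtain rfl | rfl | rfl := h.eq_or b
  · exact ⟨0, b, by rw [lie_eq_nab_sub, sub_self, map_zero, zero_smul]⟩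
  · exact ⟨_, _, lie_rxi_next h⟩
  · exact ⟨-cc F V, c, by
      rw [lie_antisymm, lie_rxi_next h.rotate.rotate, map_neg, neg_smul]⟩

theorem et_lie_rxi {a b i : Fin 3} {k : ℝ}
    (h : lie F V (rxi F V a) (rxi F V b) = algebraMap ℝ F k • rxi F V i) (X : V) :
    et F V b (lie F V (rxi F V a) X)
      = der F V (rxi F V a) (et F V b X) - algebraMap ℝ F k * et F V i X := by
  have h1 := congrArg (fun W => gm F V W X) h
  have h2 := covEta_skew (ThreeQS.qs (F := F) a) X (rxi F V b)
  simp only [lie_eq_nab_sub, gm_sub_left, gm_smul_left, gm_rxi_left] at h1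
  rw [covEta_eq, covEta_eq] at h2
  rw [et_eq b, et_eq b, der_gm, lie_eq_nab_sub, gm_sub_left]
  linear_combination -h2 - h1 - gm_symm (F := F) X (nab F V (rxi F V a) (rxi F V b))

theorem horiz_lie_rxi {X : V} (hX : Horiz F V X) (a : Fin 3) :
    Horiz F V (lie F V (rxi F V a) X) := fun b => by
  obtain ⟨k, i, h⟩ := exists_lie_rxi_eq (F := F) (V := V) a b
  rw [et_lie_rxi h, hX, hX, der_zero, mul_zero, sub_zero]

theorem two_mul_covEta (a : Fin 3) (X Y : V) :
    2 * covEta F a X Y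
      = der F V X (et F V a Y) - der F V Y (et F V a X) - et F V a (lie F V X Y) := by
  have h := two_smul_dOne_et (F := F) a X Y
  rw [dOne, smul_inv_smul₀ two_ne_zero] at h
  linear_combination -h + covEta_skew (ThreeQS.qs (F := F) a) X Y

/-- The Lie derivative of `∇η_b` along `ξ_a`. -/
theorem lieDeriv_covEta {a b i : Fin 3} {k : ℝ}
    (h : lie F V (rxi F V a) (rxi F V b) = algebraMap ℝ F k • rxi F V i) (X Y : V) :
    der F V (rxi F V a) (covEta F b X Y) - covEta F b (lie F V (rxi F V a) X) Y
      - covEta F b X (lie F V (rxi F V a) Y) = algebraMap ℝ F k * covEta F i X Y := by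
  have h0 : 2 * der F V (rxi F V a) (covEta F b X Y)
      = der F V (rxi F V a) (2 * covEta F b X Y) := by
    rw [two_mul, two_mul, der_add]
  have h1 := two_mul_covEta (F := F) b (lie F V (rxi F V a) X) Y
  have h2 := two_mul_covEta (F := F) b X (lie F V (rxi F V a) Y)
  have h3 := two_mul_covEta (F := F) i X Y
  have h4 := et_lie_rxi h (lie F V X Y)
  rw [lie_lie, et_add] at h4
  rw [two_mul_covEta] at h0
  simp only [et_lie_rxi h, der_sub, der_const_mul, der_lie] at h0 h1 h2
  refine two_mul_cancel ?_
  linear_combination h0 - h1 - h2 - algebraMap ℝ F k * h3 + h4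

theorem nab_ph_rxi_self (a : Fin 3) (X : V) :
    nab F V (ph F V a X) (rxi F V a) = ph F V a (nab F V X (rxi F V a)) := by
  refine gm_ext (F := F) fun Z => ?_
  rw [gm_ph_left, ← covEta_eq, ← covEta_eq, covEta_ph_left (ThreeQS.qs a)]

theorem ph_nab_rxi_eq (a b : Fin 3) {X : V} (hX : Horiz F V X) :
    ph F V a (nab F V X (rxi F V a)) = ph F V b (nab F V X (rxi F V b)) := by
  refine gm_ext (F := F) fun Z => ?_
  rw [← nab_ph_rxi_self, ← nab_ph_rxi_self, ← covEta_eq, ← covEta_eq,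
    covEta_skew (ThreeQS.qs a), covEta_skew (ThreeQS.qs b), covEta_ph_eq a b Z hX]

theorem nab_ph_rxi_anticomm {a b c : Fin 3} (h : Cyclic a b c) {X : V} (hX : Horiz F V X) :
    nab F V (ph F V b X) (rxi F V a) = -ph F V b (nab F V X (rxi F V a)) := by
  have ha := horiz_nab_rxi hX a
  have hb := horiz_nab_rxi hX b
  calc nab F V (ph F V b X) (rxi F V a)
      = -ph F V a (ph F V a (nab F V (ph F V b X) (rxi F V a))) := by
        rw [ph_sq_of_horiz (horiz_nab_rxi (hX.ph b) a), neg_neg]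
    _ = ph F V a (nab F V X (rxi F V b)) := by
        rw [ph_nab_rxi_eq a b (hX.ph b), nab_ph_rxi_self, ph_sq_of_horiz hb, ph_neg, neg_neg]
    _ = -ph F V a (ph F V b (ph F V a (nab F V X (rxi F V a)))) := by
        rw [ph_nab_rxi_eq a b hX, ph_sq_of_horiz hb, ph_neg, neg_neg]
    _ = -ph F V b (nab F V X (rxi F V a)) := by
        rw [ph_ph_anticomm h (ha.ph a), ph_sq_of_horiz ha, ph_neg, neg_neg]

theorem lie_rxi_ph (a b : Fin 3) {X : V} (hX : Horiz F V X) :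
    lie F V (rxi F V a) (ph F V b X) = ph F V b (lie F V (rxi F V a) X)
      + (ph F V b (nab F V X (rxi F V a)) - nab F V (ph F V b X) (rxi F V a)) := by
  have h : nab F V (rxi F V a) (ph F V b X) = ph F V b (nab F V (rxi F V a) X) := by
    refine sub_eq_zero.1 (gm_ext (F := F) fun Z => ?_)
    have h1 := covPhi_eq_covEta (ThreeQS.qs (F := F) b) (rxi F V a) X Z
    rwa [hX, covEta_rxi_left_of_horiz b a (hX.ph b), mul_zero, zero_mul, sub_zero,
      ← gm_zero_left Z] at h1
  rw [lie_eq_nab_sub, lie_eq_nab_sub, h, ph_sub]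
  abel

theorem covEta_quadratic (a : Fin 3) (X : V) {Y : V} (hY : Horiz F V Y) :
    covEta F a X ((2 : F) • ph F V a (nab F V Y (rxi F V a)) - algebraMap ℝ F (cc F V) • Y)
      = 0 := by
  obtain ⟨b, c, h⟩ := Cyclic.exists_of_fst a
  have ha := lieDeriv_covEta (F := F) (V := V) (a := a) (b := a) (i := a) (k := 0)
    (by rw [lie_eq_nab_sub, sub_self, map_zero, zero_smul]) X (ph F V a Y)
  have hb := lieDeriv_covEta (F := F) (lie_rxi_next h) X (ph F V b Y)
  have h1 : covEta F b X (lie F V (rxi F V a) (ph F V b Y))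
      = covEta F a X (lie F V (rxi F V a) (ph F V a Y))
        + 2 * covEta F a X (ph F V a (nab F V Y (rxi F V a))) := by
    rw [lie_rxi_ph a b hY, lie_rxi_ph a a hY, nab_ph_rxi_self, sub_self, add_zero,
      nab_ph_rxi_anticomm h hY, sub_neg_eq_add, covEta_add_right, covEta_add_right,
      covEta_ph_eq b a X (horiz_lie_rxi hY a), covEta_ph_eq b a X (horiz_nab_rxi hY a)]
    ring
  have h2 : covEta F c X (ph F V b Y) = -covEta F a X Y := by
    have e : ph F V b Y = ph F V c (ph F V a Y) := by
      rw [ph_ph_next h.rotate.rotate, hY, zero_smul, add_zero]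
    rw [e, covEta_ph_eq c a X (hY.ph a), covEta_ph_ph_right]
  rw [covEta_ph_eq b a _ hY, covEta_ph_eq b a _ hY, h1, h2] at hb
  rw [map_zero, zero_mul] at ha
  rw [covEta_sub_right, covEta_smul_right, covEta_smul_right]
  linear_combination ha - hb

theorem inE4m_iff {X : V} :
    InE4m F V X ↔ Horiz F V X ∧ ∀ (a : Fin 3) (Y : V), covEta F a X Y = 0 := by
  refine and_congr_right fun _ => forall₂_congr fun a Y => ?_
  rw [← smul_eq_zero_iff_right (two_ne_zero' ℝ), two_smul_dOne_et,
    covEta_skew (ThreeQS.qs a) Y X, sub_neg_eq_add, ← two_mul]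
  exact ⟨fun h => two_mul_cancel (by rw [h, mul_zero]), fun h => by rw [h, mul_zero]⟩

theorem InE4m.of_covEta_eq_zero {X : V} (hX : Horiz F V X) (a : Fin 3)
    (h : ∀ Y, covEta F a Y X = 0) : InE4m F V X := by
  refine inE4m_iff.2 ⟨hX, fun b Y => ?_⟩
  rw [covEta_skew (ThreeQS.qs b), ← covEta_ph_ph (ThreeQS.qs b), covEta_ph_eq b a _ hX,
    ← covEta_ph_left (ThreeQS.qs a), h]

theorem nab_rxi_of_inE4m {X : V} (hX : InE4m F V X) (a : Fin 3) :
    nab F V X (rxi F V a) = 0 :=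
  gm_ext (F := F) fun Z => by rw [gm_zero_left, ← covEta_eq, (inE4m_iff.1 hX).2]

theorem nab_rxi_of_inE4l {X : V} (hX : InE4l F V X) (a : Fin 3) :
    nab F V X (rxi F V a) = algebraMap ℝ F (-(cc F V / 2)) • ph F V a X := by
  have hP := horiz_nab_rxi hX.1 a
  set W := (2 : F) • ph F V a (nab F V X (rxi F V a)) - algebraMap ℝ F (cc F V) • X with hW
  have hWH : Horiz F V W := ((hP.ph a).smul _).sub (hX.1.smul _)
  have hWm : InE4m F V W :=
    .of_covEta_eq_zero hWH a fun Y => covEta_quadratic a Y hX.1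
  have hW0 : W = 0 := by
    refine eq_zero_of_orthogonal hWH (fun Y hY => ?_) fun Y hY => ?_
    · rw [gm_symm, hY.2 _ hWm]
    · rw [hW, gm_sub_left, gm_smul_left, gm_smul_left, hX.2 _ hY, gm_ph_left, ← covEta_eq,
        covEta_skew (ThreeQS.qs a), (inE4m_iff.1 (ThreeQS.phi_E4m a Y hY)).2]
      ring
  refine gm_ext (F := F) fun Z => two_mul_cancel ?_
  have h1 := congrArg (fun U => gm F V U (ph F V a Z)) hW0
  have h2 : algebraMap ℝ F (-(cc F V / 2)) * 2 = -algebraMap ℝ F (cc F V) := by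
    rw [← map_ofNat (algebraMap ℝ F) 2, ← map_mul, ← map_neg]
    congr 1
    ring
  simp only [hW, gm_sub_left, gm_smul_left, gm_zero_left, gm_ph_ph, hP a, zero_mul,
    sub_zero] at h1
  rw [gm_smul_left, gm_ph_left]
  linear_combination h1 + gm F V X (ph F V a Z) * h2

theorem nab_rxi_rxi_eq_psiT (a b : Fin 3) : nab F V (rxi F V b) (rxi F V a)
    = algebraMap ℝ F (-(cc F V / 2)) • psiT F V a (rxi F V b) := by
  rw [nab_rxi_rxi]
  by_cases hc : cc F V = 0
  · simp [hc]
  · rw [psiT, ThreeQS.psi_vert_of_ne hc]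

end threeQS

/-- In any 3-quasi-Sasakian manifold the Levi-Civita connection
satisfies `∇_X ξ_α = -(c/2) ψ_α X`. -/
theorem nabla_xi_eq (F V : Type) [CommRing F] [Algebra ℝ F] [AddCommGroup V] [Module F V]
    [SmoothSetting F V] [ACM3 F V] [ThreeQS F V] [LeviCivita F V] :
    ∀ (α : Fin 3) (X : V),
      nab F V X (rxi F V α) = algebraMap ℝ F (-(cc F V / 2)) • psiT F V α X := by
  intro α X
  obtain ⟨Y₁, Y₂, h₁, h₂, e⟩ := ThreeQS.horiz_split _ (horiz_horComp (F := F) X)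
  have hX : X = Y₁ + Y₂ + ∑ i : Fin 3, et F V i X • rxi F V i := by
    rw [← e, horComp, sub_add_cancel]
  have hl : psiT F V α Y₁ = ph F V α Y₁ := ThreeQS.psi_E4l α Y₁ h₁
  have hm : psiT F V α Y₂ = 0 := ThreeQS.psi_E4m α Y₂ h₂
  rw [hX, Fin.sum_univ_three]
  simp only [nab_add_left, nab_smul_left, psiT_add, psiT_smul, hl, hm, nab_rxi_of_inE4l h₁,
    nab_rxi_of_inE4m h₂, nab_rxi_rxi_eq_psiT, smul_add, smul_comm (et F V _ X), smul_zero]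

end QS3
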